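/- arXiv:2302.12613 — 3 statements merged into one kernel-verified Lean document; each statement's English description precedes it below -/
import Mathlib

section
/- Let w : ℝ → ℝ^m be Bochner integrable with w(t) = 0 for almost every t < 0. Then the function t ↦ F(w(t+·)), whose j-th component is Σ_{k=1}^m ∫_{[-τ,0]} w_k(t+θ) dη_{jk}(θ), is integrable on [0,∞), and ∫₀^∞ F(w(t+·)) dt = F̂ (∫₀^∞ w(s) ds). -/
open Set Filter Topology MeasureTheory

noncomputable section

/-- Integral of a real-valued function against a finite signed Borel measure, via the
Jordan decomposition `s = s⁺ - s⁻`. -/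
def sIntegral {α : Type*} [MeasurableSpace α] (s : MeasureTheory.SignedMeasure α)
    (f : α → ℝ) : ℝ :=
  (∫ x, f x ∂s.toJordanDecomposition.posPart) - ∫ x, f x ∂s.toJordanDecomposition.negPart

theorem delayed_aux (τ : ℝ) (μ : Measure (Set.Icc (-τ) (0:ℝ))) [IsFiniteMeasure μ]
    (g : ℝ → ℝ) (hg : Integrable g) (hg0 : ∀ᵐ t : ℝ, t < 0 → g t = 0) :
    (∀ᵐ t : ℝ ∂(volume.restrict (Set.Ici (0:ℝ))),
      Integrable (fun θ : Set.Icc (-τ) (0:ℝ) => g (t + θ.val)) μ) ∧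
    Integrable (fun t : ℝ => ∫ θ : Set.Icc (-τ) (0:ℝ), g (t + θ.val) ∂μ)
      (volume.restrict (Set.Ici (0:ℝ))) ∧
    (∫ t in Set.Ici (0:ℝ), ∫ θ : Set.Icc (-τ) (0:ℝ), g (t + θ.val) ∂μ)
      = μ.real Set.univ * ∫ s in Set.Ici (0:ℝ), g s := by
  have hmp : MeasurePreserving
      (fun p : Set.Icc (-τ) (0:ℝ) × ℝ => (p.1, p.2 + p.1.val))
      (μ.prod volume) (μ.prod volume) := by
    refine MeasurePreserving.skew_product (f := id)
      (g := fun (θ : Set.Icc (-τ) (0:ℝ)) (t : ℝ) => t + θ.val)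
      (MeasurePreserving.id μ) ?_ ?_
    · exact measurable_snd.add (measurable_subtype_coe.comp measurable_fst)
    · exact Filter.Eventually.of_forall fun θ =>
        (measurePreserving_add_right volume θ.val).map_eq
  have h1 : Integrable (fun p : Set.Icc (-τ) (0:ℝ) × ℝ => g (p.2 + p.1.val))
      (μ.prod volume) :=
    hmp.integrable_comp_of_integrable (hg.comp_snd μ)
  have h2 : Integrable (fun p : ℝ × Set.Icc (-τ) (0:ℝ) => g (p.1 + p.2.val))
      (volume.prod μ) := h1.swap
  have h3 : Integrable (fun p : ℝ × Set.Icc (-τ) (0:ℝ) => g (p.1 + p.2.val))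
      ((volume.restrict (Set.Ici (0:ℝ))).prod μ) :=
    h2.mono_measure (Measure.prod_mono Measure.restrict_le_self le_rfl)
  refine ⟨h3.prod_right_ae, h3.integral_prod_left, ?_⟩
  rw [integral_integral_swap h3]
  have key : ∀ θ : Set.Icc (-τ) (0:ℝ),
      ∫ t in Set.Ici (0:ℝ), g (t + θ.val) = ∫ s in Set.Ici (0:ℝ), g s := by
    intro θ
    have e := (measurePreserving_add_right volume θ.val).setIntegral_preimage_emb
      (measurableEmbedding_addRight θ.val) g (Set.Ici θ.val)
    have hs : (fun x => x + θ.val) ⁻¹' Set.Ici θ.val = Set.Ici (0:ℝ) := by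
      ext x; simp
    rw [hs] at e
    rw [e]
    refine setIntegral_eq_of_subset_of_ae_diff_eq_zero
      measurableSet_Ici.nullMeasurableSet (Set.Ici_subset_Ici.2 θ.2.2) ?_
    filter_upwards [hg0] with t ht h
    exact ht (not_le.1 h.2)
  simp_rw [key]
  simp

theorem signed_univ_aux {α : Type*} [MeasurableSpace α] (s : SignedMeasure α) :
    s Set.univ = s.toJordanDecomposition.posPart.real Set.univ
      - s.toJordanDecomposition.negPart.real Set.univ := by
  conv_lhs => rw [← s.toSignedMeasure_toJordanDecomposition]
  simp [JordanDecomposition.toSignedMeasure, Measure.toSignedMeasure_apply]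

/-- Let `η = (η_{jk})` be an `m × m` matrix of finite signed Borel measures
on `[-τ,0]` and `w : ℝ → ℝ^m` Bochner integrable with `w(t) = 0` for a.e. `t < 0`. Then the
function `t ↦ F(w(t+·))`, with `j`-th component `Σ_k ∫_{[-τ,0]} w_k(t+θ) dη_{jk}(θ)`, is
(a.e. well defined and) integrable on `[0,∞)`, and
`∫₀^∞ F(w(t+·)) dt = F̂ (∫₀^∞ w(s)ds)`, where `F̂_{jk} = η_{jk}([-τ,0])`. -/
theorem integral_of_delayed_evaluation
    (τ : ℝ) (hτ : 0 ≤ τ) (m : ℕ) (hm : 1 ≤ m)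
    (η : Fin m → Fin m → MeasureTheory.SignedMeasure (Set.Icc (-τ) (0:ℝ)))
    (w : ℝ → Fin m → ℝ) (hw : MeasureTheory.Integrable w)
    (hw0 : ∀ᵐ t : ℝ, t < 0 → w t = 0) :
    (∀ j k : Fin m, ∀ᵐ t : ℝ ∂(MeasureTheory.volume.restrict (Set.Ici (0:ℝ))),
      MeasureTheory.Integrable (fun θ : Set.Icc (-τ) (0:ℝ) => w (t + θ.val) k)
        (η j k).totalVariation) ∧
    MeasureTheory.IntegrableOn
      (fun t : ℝ => fun j : Fin m =>
        ∑ k : Fin m, sIntegral (η j k) (fun θ => w (t + θ.val) k))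
      (Set.Ici (0:ℝ)) ∧
    (∫ t in Set.Ici (0:ℝ), fun j : Fin m =>
        ∑ k : Fin m, sIntegral (η j k) (fun θ => w (t + θ.val) k))
      = (Matrix.of fun j k : Fin m => η j k Set.univ).mulVec
          (∫ s in Set.Ici (0:ℝ), w s) := by
  have hwk : ∀ k, Integrable (fun t => w t k) := fun k => hw.eval k
  have hk0 : ∀ k, ∀ᵐ t : ℝ, t < 0 → w t k = 0 := fun k => by
    filter_upwards [hw0] with t ht h
    rw [ht h]; rfl
  have P := fun j k => delayed_aux τ (η j k).toJordanDecomposition.posPart _ (hwk k) (hk0 k)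
  have N := fun j k => delayed_aux τ (η j k).toJordanDecomposition.negPart _ (hwk k) (hk0 k)
  have hS : ∀ j k, Integrable (fun t : ℝ => sIntegral (η j k) (fun θ => w (t + θ.val) k))
      (volume.restrict (Set.Ici (0:ℝ))) := fun j k => (P j k).2.1.sub (N j k).2.1
  have hI : ∀ j, Integrable
      (fun t : ℝ => ∑ k : Fin m, sIntegral (η j k) (fun θ => w (t + θ.val) k))
      (volume.restrict (Set.Ici (0:ℝ))) := fun j =>
    integrable_finset_sum _ fun k _ => hS j k
  refine ⟨fun j k => ?_, Integrable.of_eval hI, ?_⟩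
  · filter_upwards [(P j k).1, (N j k).1] with t h1 h2
    exact h1.add_measure h2
  · ext j
    rw [eval_integral hI, integral_finset_sum _ fun k _ => hS j k]
    simp only [Matrix.mulVec, dotProduct, Matrix.of_apply]
    refine Finset.sum_congr rfl fun k _ => ?_
    rw [eval_integral fun k => (hwk k).integrableOn, signed_univ_aux, sub_mul,
      ← (P j k).2.2, ← (N j k).2.2]
    exact integral_sub (P j k).2.1 (N j k).2.1
end
end

section
/- If R₀ > 1, then there exists a unique quadruple (L*, N*, A_q*, A_f*) of positive real numbers satisfying the equilibrium equations b r₄ e^{−d₄τ₁} A_f* = (d₁+r₁)L*, r₁ g(L*) = (d₂+r₂)N*, r₂ N* = (d₃+r₃)A_q*, and (r₃/2) e^{−d₃τ₂} A_q* = (d₄+r₄)A_f*. -/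
open Set Filter Topology

noncomputable section

theorem tick_aux (a c r₁ r₂ s₁ s₂ s₃ s₄ M h : ℝ)
    (hr₁ : 0 < r₁) (hr₂ : 0 < r₂) (ha : 0 < a) (hc : 0 < c)
    (h1 : 0 < s₁) (h2 : 0 < s₂) (h3 : 0 < s₃) (h4 : 0 < s₄) (hM : 0 < M) (hh : 0 < h)
    (hR : s₁ * s₂ * s₃ * s₄ * h < a * c * r₁ * r₂ * M) :
    ∃! q : ℝ × ℝ × ℝ × ℝ,
      (0 < q.1 ∧ 0 < q.2.1 ∧ 0 < q.2.2.1 ∧ 0 < q.2.2.2) ∧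
      a * q.2.2.2 = s₁ * q.1 ∧
      r₁ * (M * q.1 / (h + q.1)) = s₂ * q.2.1 ∧
      r₂ * q.2.1 = s₃ * q.2.2.1 ∧
      c * q.2.2.1 = s₄ * q.2.2.2 := by
  have hS : 0 < s₁ * s₂ * s₃ * s₄ := by positivity
  obtain ⟨L, hLdef⟩ : ∃ L, L = a * c * r₁ * r₂ * M / (s₁ * s₂ * s₃ * s₄) - h := ⟨_, rfl⟩
  have hL : 0 < L := by
    rw [hLdef, sub_pos, lt_div_iff₀ hS]
    linarith
  have hLS : s₁ * s₂ * s₃ * s₄ * (h + L) = a * c * r₁ * r₂ * M := by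
    rw [hLdef]
    field_simp
    ring
  have hhL : 0 < h + L := by positivity
  refine ⟨(L, r₁ * (M * L / (h + L)) / s₂, r₂ * (r₁ * (M * L / (h + L)) / s₂) / s₃,
    s₁ * L / a), ⟨⟨hL, by positivity, by positivity, by positivity⟩, ?_, ?_, ?_, ?_⟩, ?_⟩
  · dsimp only
    field_simp
  · dsimp only
    field_simp
  · dsimp only
    field_simp
  · dsimp only
    field_simp
    linarith
  · rintro ⟨x, n, q, f⟩ ⟨⟨hx, hn, hq, hf⟩, e1, e2, e3, e4⟩
    dsimp only at *
    have hhx : 0 < h + x := by positivity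
    have hn' : n = r₁ * (M * x / (h + x)) / s₂ := by
      rw [eq_div_iff h2.ne']
      linarith
    have hq' : q = r₂ * n / s₃ := by
      rw [eq_div_iff h3.ne']
      linarith
    have hf' : f = s₁ * x / a := by
      rw [eq_div_iff ha.ne']
      linarith
    have key : s₁ * s₂ * s₃ * s₄ * (h + x) = a * c * r₁ * r₂ * M := by
      rw [hq', hn', hf'] at e4
      field_simp at e4
      linarith
    have hxL : x = L := by
      have := mul_left_cancel₀ hS.ne' (key.trans hLS.symm)
      linarith
    subst hxL
    rw [hq', hn', hf']

/-- If `R₀ > 1`, then the black-legged tick model has a unique positive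
equilibrium `(L*, N*, A_q*, A_f*)`, i.e. a unique quadruple of positive reals satisfying
`b r₄ e^{-d₄τ₁} A_f* = (d₁+r₁)L*`, `r₁ g(L*) = (d₂+r₂)N*`, `r₂ N* = (d₃+r₃)A_q*`, and
`(r₃/2) e^{-d₃τ₂} A_q* = (d₄+r₄)A_f*`, where `g(x) = N_cap x/(h+x)`. -/
theorem tick_model_unique_positive_equilibrium
    (b r₁ r₂ r₃ r₄ d₁ d₂ d₃ d₄ τ₁ τ₂ Ncap h : ℝ)
    (hb : 0 < b) (hr₁ : 0 < r₁) (hr₂ : 0 < r₂) (hr₃ : 0 < r₃) (hr₄ : 0 < r₄)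
    (hd₁ : 0 < d₁) (hd₂ : 0 < d₂) (hd₃ : 0 < d₃) (hd₄ : 0 < d₄)
    (hτ₁ : 0 < τ₁) (hτ₂ : 0 < τ₂) (hN : 0 < Ncap) (hh : 0 < h)
    (hR₀ : 1 < 1 / 2 * b * (Ncap / h) * Real.exp (-(d₄ * τ₁ + d₃ * τ₂)) *
        (r₁ / (d₁ + r₁)) * (r₂ / (d₂ + r₂)) * (r₃ / (d₃ + r₃)) * (r₄ / (d₄ + r₄))) :
    ∃! q : ℝ × ℝ × ℝ × ℝ,
      (0 < q.1 ∧ 0 < q.2.1 ∧ 0 < q.2.2.1 ∧ 0 < q.2.2.2) ∧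
      b * r₄ * Real.exp (-(d₄ * τ₁)) * q.2.2.2 = (d₁ + r₁) * q.1 ∧
      r₁ * (Ncap * q.1 / (h + q.1)) = (d₂ + r₂) * q.2.1 ∧
      r₂ * q.2.1 = (d₃ + r₃) * q.2.2.1 ∧
      r₃ / 2 * Real.exp (-(d₃ * τ₂)) * q.2.2.1 = (d₄ + r₄) * q.2.2.2 := by
  have e : Real.exp (-(d₄ * τ₁ + d₃ * τ₂)) = Real.exp (-(d₄ * τ₁)) * Real.exp (-(d₃ * τ₂)) := by
    rw [← Real.exp_add]
    congr 1
    ring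
  rw [e] at hR₀
  have hP := Real.exp_pos (-(d₄ * τ₁))
  have hQ := Real.exp_pos (-(d₃ * τ₂))
  generalize Real.exp (-(d₄ * τ₁)) = P at *
  generalize Real.exp (-(d₃ * τ₂)) = Q at *
  apply tick_aux (b * r₄ * P) (r₃ / 2 * Q) r₁ r₂ (d₁ + r₁) (d₂ + r₂) (d₃ + r₃) (d₄ + r₄) Ncap h <;>
    try positivity
  have hS : 0 < (d₁ + r₁) * (d₂ + r₂) * (d₃ + r₃) * (d₄ + r₄) * h := by positivity
  have e2 : 1 / 2 * b * (Ncap / h) * (P * Q) *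
        (r₁ / (d₁ + r₁)) * (r₂ / (d₂ + r₂)) * (r₃ / (d₃ + r₃)) * (r₄ / (d₄ + r₄)) =
      (b * r₄ * P * (r₃ / 2 * Q) * r₁ * r₂ * Ncap) /
        ((d₁ + r₁) * (d₂ + r₂) * (d₃ + r₃) * (d₄ + r₄) * h) := by
    field_simp
  rwa [e2, one_lt_div hS] at hR₀
end
end

section
/- If R₀ ≤ 1, then every nonnegative solution u = (L, N, A_q, A_f) of the black-legged tick model converges to (0,0,0,0) as t → ∞. -/
open Set Filter Topology

noncomputable section

/-- `c` is an asymptotic upper bound of `f` at infinity. -/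
def EUB (f : ℝ → ℝ) (c : ℝ) : Prop := ∀ ε : ℝ, 0 < ε → ∀ᶠ t in atTop, f t ≤ c + ε

theorem EUB.shift {f : ℝ → ℝ} {c : ℝ} (hf : EUB f c) (τ : ℝ) : EUB (fun t => f (t - τ)) c := by
  intro ε hε
  exact (tendsto_atTop_add_const_right atTop (-τ) tendsto_id).eventually (hf ε hε)

theorem EUB.const_mul {f : ℝ → ℝ} {c k : ℝ} (hk : 0 < k) (hf : EUB f c) :
    EUB (fun t => k * f t) (k * c) := by
  intro ε hε
  filter_upwards [hf (ε / k) (by positivity)] with t ht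
  have := mul_le_mul_of_nonneg_left ht hk.le
  rwa [mul_add, mul_div_cancel₀ _ hk.ne'] at this

theorem EUB.ode {f p : ℝ → ℝ} {c a : ℝ} (ha : 0 < a)
    (hd : ∀ t, 0 < t → HasDerivAt f (p t - a * f t) t) (hp : EUB p c) : EUB f (c / a) := by
  intro ε hε
  obtain ⟨T0, hT0⟩ := eventually_atTop.1 (hp (a * (ε / 2)) (by positivity))
  set T := max T0 1 with hT
  have hT1 : 1 ≤ T := le_max_right _ _
  have hT2 : T0 ≤ T := le_max_left _ _
  set C := c / a + ε / 2 with hC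
  have haC : a * C = c + a * (ε / 2) := by rw [hC]; field_simp
  have hder : ∀ t, 0 < t → HasDerivAt (fun t => (f t - C) * Real.exp (a * t))
      ((p t - a * f t) * Real.exp (a * t) + (f t - C) * (Real.exp (a * t) * (a * 1))) t := by
    intro t ht
    exact ((hd t ht).sub_const C).mul (((hasDerivAt_id t).const_mul a).exp)
  have hanti : AntitoneOn (fun t => (f t - C) * Real.exp (a * t)) (Ici T) := by
    apply antitoneOn_of_hasDerivWithinAt_nonpos (convex_Ici T)
      (f' := fun t => (p t - a * f t) * Real.exp (a * t) +
        (f t - C) * (Real.exp (a * t) * (a * 1)))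
    · intro t ht
      have ht' : T ≤ t := ht
      exact (hder t (by linarith)).continuousAt.continuousWithinAt
    · intro t ht
      rw [interior_Ici] at ht
      have ht' : T < t := ht
      exact (hder t (by linarith)).hasDerivWithinAt
    · intro t ht
      rw [interior_Ici] at ht
      have ht' : T < t := ht
      have h1 := hT0 t (by linarith)
      have h2 : (p t - a * C) * Real.exp (a * t) ≤ 0 :=
        mul_nonpos_of_nonpos_of_nonneg (by linarith) (Real.exp_pos _).le
      nlinarith
  have hlim : Tendsto (fun t => (f T - C) * Real.exp (a * T) * Real.exp (-(a * t)))
      atTop (𝓝 0) := by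
    have h1 : Tendsto (fun t : ℝ => Real.exp (-(a * t))) atTop (𝓝 0) :=
      Real.tendsto_exp_neg_atTop_nhds_zero.comp (tendsto_id.const_mul_atTop ha)
    simpa using h1.const_mul ((f T - C) * Real.exp (a * T))
  filter_upwards [hlim.eventually (gt_mem_nhds (half_pos hε)), eventually_ge_atTop T] with t h1 h2
  have h3 : (f t - C) * Real.exp (a * t) ≤ (f T - C) * Real.exp (a * T) :=
    hanti self_mem_Ici h2 h2
  have h4 := mul_le_mul_of_nonneg_right h3 (Real.exp_pos (-(a * t))).le
  rw [mul_assoc (f t - C), ← Real.exp_add, add_neg_cancel, Real.exp_zero, mul_one] at h4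
  linarith

theorem EUB.sat {f : ℝ → ℝ} {c K h : ℝ} (hK : 0 < K) (hh : 0 < h) (hc : 0 ≤ c)
    (hpos : ∀ᶠ t in atTop, 0 ≤ f t) (hf : EUB f c) :
    EUB (fun t => K * f t / (h + f t)) (K * c / (h + c)) := by
  intro ε hε
  filter_upwards [hf (ε * h / K) (by positivity), hpos] with t ht h0
  have hδ : 0 < ε * h / K := by positivity
  have hKδ : K * (ε * h / K) = ε * h := by field_simp
  have h1 : K * f t ≤ K * c + ε * h := by
    have := mul_le_mul_of_nonneg_left ht hK.le
    linarith
  rw [div_add' _ _ _ (by positivity), div_le_div_iff₀ (by positivity) (by positivity)]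
  have h2 : h * (K * f t) ≤ h * (K * c + ε * h) := mul_le_mul_of_nonneg_left h1 hh.le
  have h3 : 0 ≤ ε * (h * f t + h * c + c * f t) := by positivity
  nlinarith

theorem EUB.tendsto {f : ℝ → ℝ} (hpos : ∀ᶠ t in atTop, 0 ≤ f t) (hf : EUB f 0) :
    Tendsto f atTop (𝓝 0) := by
  rw [Metric.tendsto_nhds]
  intro ε hε
  filter_upwards [hf (ε / 2) (by positivity), hpos] with t h1 h2
  rw [Real.dist_eq, sub_zero, abs_of_nonneg h2]
  linarith

/-- If `R₀ ≤ 1`, then every nonnegative solution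
`u = (L, N, A_q, A_f)` of the black-legged tick model converges to `(0,0,0,0)`
as `t → ∞`. -/
theorem tick_model_extinction_when_R0_le_one
    (b r₁ r₂ r₃ r₄ d₁ d₂ d₃ d₄ τ₁ τ₂ Ncap h : ℝ)
    (hb : 0 < b) (hr₁ : 0 < r₁) (hr₂ : 0 < r₂) (hr₃ : 0 < r₃) (hr₄ : 0 < r₄)
    (hd₁ : 0 < d₁) (hd₂ : 0 < d₂) (hd₃ : 0 < d₃) (hd₄ : 0 < d₄)
    (hτ₁ : 0 < τ₁) (hτ₂ : 0 < τ₂) (hN : 0 < Ncap) (hh : 0 < h)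
    (hR₀ : 1 / 2 * b * (Ncap / h) * Real.exp (-(d₄ * τ₁ + d₃ * τ₂)) *
        (r₁ / (d₁ + r₁)) * (r₂ / (d₂ + r₂)) * (r₃ / (d₃ + r₃)) * (r₄ / (d₄ + r₄)) ≤ 1)
    (L N Aq Af : ℝ → ℝ)
    (hLc : ContinuousOn L (Set.Ici (-(max τ₁ τ₂))))
    (hNc : ContinuousOn N (Set.Ici (-(max τ₁ τ₂))))
    (hAqc : ContinuousOn Aq (Set.Ici (-(max τ₁ τ₂))))
    (hAfc : ContinuousOn Af (Set.Ici (-(max τ₁ τ₂))))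
    (hpos : ∀ t ∈ Set.Ici (-(max τ₁ τ₂)), 0 ≤ L t ∧ 0 ≤ N t ∧ 0 ≤ Aq t ∧ 0 ≤ Af t)
    (hL : ∀ t : ℝ, 0 < t →
      HasDerivAt L (b * r₄ * Real.exp (-(d₄ * τ₁)) * Af (t - τ₁) - (d₁ + r₁) * L t) t)
    (hN' : ∀ t : ℝ, 0 < t →
      HasDerivAt N (r₁ * (Ncap * L t / (h + L t)) - (d₂ + r₂) * N t) t)
    (hAq : ∀ t : ℝ, 0 < t →
      HasDerivAt Aq (r₂ * N t - (d₃ + r₃) * Aq t) t)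
    (hAf : ∀ t : ℝ, 0 < t →
      HasDerivAt Af (r₃ / 2 * Real.exp (-(d₃ * τ₂)) * Aq (t - τ₂) - (d₄ + r₄) * Af t) t) :
    Filter.Tendsto L Filter.atTop (nhds 0) ∧
    Filter.Tendsto N Filter.atTop (nhds 0) ∧
    Filter.Tendsto Aq Filter.atTop (nhds 0) ∧
    Filter.Tendsto Af Filter.atTop (nhds 0) := by
  have hev : ∀ᶠ t in atTop, 0 ≤ L t ∧ 0 ≤ N t ∧ 0 ≤ Aq t ∧ 0 ≤ Af t := by
    filter_upwards [eventually_ge_atTop (-(max τ₁ τ₂))] with t ht using hpos t ht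
  have hL0 : ∀ᶠ t in atTop, 0 ≤ L t := hev.mono fun t ht => ht.1
  -- one turn of the life cycle
  have chainN : ∀ G, EUB (fun t => Ncap * L t / (h + L t)) G →
      EUB N (r₁ * G / (d₂ + r₂)) := fun G hG =>
    EUB.ode (add_pos hd₂ hr₂) hN' (hG.const_mul hr₁)
  have chainAq : ∀ G, EUB N G → EUB Aq (r₂ * G / (d₃ + r₃)) := fun G hG =>
    EUB.ode (add_pos hd₃ hr₃) hAq (hG.const_mul hr₂)
  have chainAf : ∀ G, EUB Aq G →
      EUB Af (r₃ / 2 * Real.exp (-(d₃ * τ₂)) * G / (d₄ + r₄)) := fun G hG =>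
    EUB.ode (add_pos hd₄ hr₄) hAf ((hG.shift τ₂).const_mul (by positivity))
  have chainL : ∀ G, EUB Af G →
      EUB L (b * r₄ * Real.exp (-(d₄ * τ₁)) * G / (d₁ + r₁)) := fun G hG =>
    EUB.ode (add_pos hd₁ hr₁) hL ((hG.shift τ₁).const_mul (by positivity))
  set R := 1 / 2 * b * (Ncap / h) * Real.exp (-(d₄ * τ₁ + d₃ * τ₂)) *
        (r₁ / (d₁ + r₁)) * (r₂ / (d₂ + r₂)) * (r₃ / (d₃ + r₃)) * (r₄ / (d₄ + r₄)) with hR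
  have hRpos : 0 < R := by positivity
  have chain : ∀ G, EUB (fun t => Ncap * L t / (h + L t)) G → EUB L (R * (h / Ncap) * G) := by
    intro G hG
    have h1 := chainL _ (chainAf _ (chainAq _ (chainN G hG)))
    convert h1 using 1
    have he : Real.exp (-(d₄ * τ₁ + d₃ * τ₂)) =
        Real.exp (-(d₄ * τ₁)) * Real.exp (-(d₃ * τ₂)) := by
      rw [← Real.exp_add]; congr 1; ring
    rw [hR, he]
    field_simp
  have hbdd : EUB (fun t => Ncap * L t / (h + L t)) Ncap := by
    intro ε hε
    filter_upwards [hL0] with t ht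
    rw [div_le_iff₀ (by positivity)]
    have h1 : 0 ≤ ε * (h + L t) := by positivity
    have h2 : 0 < Ncap * h := by positivity
    nlinarith
  let S : Set ℝ := {c | 0 ≤ c ∧ EUB L c}
  have hSne : S.Nonempty := ⟨_, by positivity, chain _ hbdd⟩
  have hSb : BddBelow S := ⟨0, fun c hc => hc.1⟩
  set l := sInf S with hl
  have hl0 : 0 ≤ l := le_csInf hSne fun c hc => hc.1
  have hlE : EUB L l := by
    intro ε hε
    obtain ⟨c, hc, hcl⟩ := exists_lt_of_csInf_lt hSne (show sInf S < l + ε / 2 by linarith)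
    filter_upwards [hc.2 (ε / 2) (by positivity)] with t ht
    linarith
  have hg := EUB.sat hN hh hl0 hL0 hlE
  have hle : l ≤ R * (h / Ncap) * (Ncap * l / (h + l)) :=
    csInf_le hSb ⟨by positivity, chain _ hg⟩
  have hlz : l = 0 := by
    have h1 : R * (h / Ncap) * (Ncap * l / (h + l)) = R * (h * l) / (h + l) := by
      field_simp
    rw [h1, le_div_iff₀ (by positivity)] at hle
    have h2 : R * (h * l) ≤ 1 * (h * l) := mul_le_mul_of_nonneg_right hR₀ (by positivity)
    nlinarith
  rw [hlz] at hlE hg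
  have eN := chainN _ hg
  have eAq := chainAq _ eN
  have eAf := chainAf _ eAq
  simp only [mul_zero, zero_div] at eN eAq eAf
  exact ⟨hlE.tendsto hL0, eN.tendsto (hev.mono fun t ht => ht.2.1),
    eAq.tendsto (hev.mono fun t ht => ht.2.2.1), eAf.tendsto (hev.mono fun t ht => ht.2.2.2)⟩
end
end
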